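/- arXiv:1212.2859 — 3 statements merged into one kernel-verified Lean document; each statement's English description precedes it below -/
import Mathlib

section
/- Let k be a field, (C, b, B) and (C′, b′, B′) mixed complexes over k, and φ : C → C′ a morphism of mixed complexes (a k-linear map with φ ∘ b = b′ ∘ φ and φ ∘ B = B′ ∘ φ). Assume φ is a quasi-isomorphism, i.e. φ maps ker b into ker b′ and range b into range b′, and the induced map ker b / range b → ker b′ / range b′ is bijective. Then the coefficientwise map φ((u)) : C((u)) → C′((u)) is a quasi-isomorphism for the total differentials: the induced map ker D / range D → ker D′ / range D′ is bijective, where D = b + uB and D′ = b′ + uB′ are the total differentials on the Laurent modules. -/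
/-- If `b` is exact on `K`, then `b + uB` is exact on sequences supported in degrees `≥ N`. -/
lemma exists_total_eq_of_acyclic {R K : Type*} [Ring R] [AddCommGroup K] [Module R K]
    (b B : K →ₗ[R] K) (hBB : ∀ x, B (B x) = 0) (hbB : ∀ x, b (B x) + B (b x) = 0)
    (hb : ∀ x, b x = 0 → ∃ y, b y = x) (N : ℤ) (z : ℤ → K) (hz : ∀ n < N, z n = 0)
    (hcycle : ∀ n, b (z n) + B (z (n - 1)) = 0) :
    ∃ w : ℤ → K, (∀ n < N, w n = 0) ∧ ∀ n, b (w n) + B (w (n - 1)) = z n := by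
  choose! s hs using hb
  let v : ℕ → K := fun n => Nat.rec (s (z N)) (fun m y => s (z (N + (m + 1 : ℕ)) - B y)) n
  have hv : ∀ m : ℕ, v (m + 1) = s (z (N + (m + 1 : ℕ)) - B (v m)) := fun m => rfl
  have hv₀ : b (v 0) = z N := hs _ <| by
    simpa [hz (N - 1) (by lia)] using hcycle N
  have hB : ∀ m : ℕ, B (b (v m)) = B (z (N + m)) →
      b (v (m + 1)) = z (N + (m + 1 : ℕ)) - B (v m) := fun m hm => by
    rw [hv]
    apply hs
    have h₁ := hcycle (N + (m + 1 : ℕ))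
    rw [show N + ((m + 1 : ℕ) : ℤ) - 1 = N + m by push_cast; ring, ← hm] at h₁
    rw [map_sub, eq_neg_of_add_eq_zero_left h₁, eq_neg_of_add_eq_zero_left (hbB (v m)), sub_self]
  have hBv : ∀ m : ℕ, B (b (v m)) = B (z (N + m)) := fun m => by
    induction m with
    | zero => simp [hv₀]
    | succ m ih => rw [hB m ih, map_sub, hBB, sub_zero]
  refine ⟨fun n => if n < N then 0 else v (n - N).toNat, fun n hn => if_pos hn, fun n => ?_⟩
  rcases lt_or_ge n N with hn | hn
  · simp [hn, show n - 1 < N by lia, hz n hn]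
  · obtain ⟨m, rfl⟩ := Int.le.dest hn
    cases m with
    | zero => simp [hv₀]
    | succ m =>
      have h₁ : ¬ N + ((m + 1 : ℕ) : ℤ) < N := by lia
      have h₂ : ¬ N + ((m + 1 : ℕ) : ℤ) - 1 < N := by lia
      have h₃ : (N + ((m + 1 : ℕ) : ℤ) - N).toNat = m + 1 := by lia
      have h₄ : (N + ((m + 1 : ℕ) : ℤ) - 1 - N).toNat = m := by lia
      simp only [h₁, h₂, if_false, h₃, h₄]
      rw [hB m (hBv m), sub_add_cancel]

/-- The `b`-differential of the mapping cone of `φ`. -/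
def coneDifferential {R C C' : Type*} [Ring R] [AddCommGroup C] [Module R C]
    [AddCommGroup C'] [Module R C'] (b : C →ₗ[R] C) (b' : C' →ₗ[R] C') (φ : C →ₗ[R] C') :
    C × C' →ₗ[R] C × C' :=
  (-(b ∘ₗ LinearMap.fst R C C')).prod (φ.coprod b')

/-- The mapping cone of a quasi-isomorphism is acyclic. -/
lemma exists_coneDifferential_eq {R C C' : Type*} [Ring R] [AddCommGroup C] [Module R C]
    [AddCommGroup C'] [Module R C'] (b : C →ₗ[R] C) (b' : C' →ₗ[R] C') (φ : C →ₗ[R] C')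
    (hφb : ∀ x, φ (b x) = b' (φ x))
    (hsurj : ∀ x' : C', b' x' = 0 → ∃ x : C, b x = 0 ∧ φ x - x' ∈ LinearMap.range b')
    (hinj : ∀ x : C, b x = 0 → φ x ∈ LinearMap.range b' → x ∈ LinearMap.range b)
    (p : C × C') (hp : coneDifferential b b' φ p = 0) :
    ∃ q, coneDifferential b b' φ q = p := by
  obtain ⟨x, y⟩ := p
  simp only [coneDifferential, LinearMap.prod_apply, Function.prod, LinearMap.neg_apply,
    LinearMap.comp_apply, LinearMap.fst_apply, LinearMap.coprod_apply, Prod.mk_eq_zero,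
    neg_eq_zero] at hp
  obtain ⟨hx, hxy⟩ := hp
  obtain ⟨a, ha⟩ := hinj x hx ⟨-y, by rw [map_neg, eq_neg_of_add_eq_zero_left hxy]⟩
  have hcycle : b' (y + φ a) = 0 := by
    rw [map_add, ← hφb, ha, add_comm, hxy]
  obtain ⟨c, hc, e, he⟩ := hsurj _ hcycle
  refine ⟨(c - a, -e), ?_⟩
  simp only [coneDifferential, LinearMap.prod_apply, Function.prod, LinearMap.neg_apply,
    LinearMap.comp_apply, LinearMap.fst_apply, LinearMap.coprod_apply, map_sub, map_neg, hc, ha, he]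
  ext <;> simp

/-- The cone of `φ((u))` is acyclic when `φ` is a quasi-isomorphism of mixed complexes. -/
lemma exists_total_cone_eq {R C C' : Type*} [Ring R] [AddCommGroup C] [Module R C]
    [AddCommGroup C'] [Module R C'] (b B : C →ₗ[R] C) (b' B' : C' →ₗ[R] C') (φ : C →ₗ[R] C')
    (hBB : ∀ x, B (B x) = 0) (hbB : ∀ x, b (B x) + B (b x) = 0)
    (hBB' : ∀ y, B' (B' y) = 0)
    (hbB' : ∀ y, b' (B' y) + B' (b' y) = 0)
    (hφb : ∀ x, φ (b x) = b' (φ x)) (hφB : ∀ x, φ (B x) = B' (φ x))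
    (hsurj : ∀ x' : C', b' x' = 0 → ∃ x : C, b x = 0 ∧ φ x - x' ∈ LinearMap.range b')
    (hinj : ∀ x : C, b x = 0 → φ x ∈ LinearMap.range b' → x ∈ LinearMap.range b)
    (f : HahnSeries ℤ C) (g : HahnSeries ℤ C')
    (hf : ∀ n, b (f.coeff n) + B (f.coeff (n - 1)) = 0)
    (hfg : ∀ n, φ (f.coeff n) + (b' (g.coeff n) + B' (g.coeff (n - 1))) = 0) :
    ∃ (x : HahnSeries ℤ C) (y : HahnSeries ℤ C'),
      (∀ n, -(b (x.coeff n) + B (x.coeff (n - 1))) = f.coeff n) ∧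
      ∀ n, φ (x.coeff n) + (b' (y.coeff n) + B' (y.coeff (n - 1))) = g.coeff n := by
  obtain ⟨w, hw, hDw⟩ := exists_total_eq_of_acyclic (coneDifferential b b' φ)
    ((-B).prodMap B') (by simp [hBB, hBB'])
    (fun p => by
      ext
      · simpa [coneDifferential] using hbB p.1
      · simp only [coneDifferential, LinearMap.prod_apply, Function.prod, LinearMap.neg_apply,
          LinearMap.comp_apply, LinearMap.fst_apply, LinearMap.coprod_apply,
          LinearMap.prodMap_apply, map_neg, map_add, hφB, Prod.snd_add, Prod.snd_zero]
        rw [← hbB' p.2]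
        abel)
    (exists_coneDifferential_eq b b' φ hφb hsurj hinj) (min f.order g.order)
    (fun n => (f.coeff n, g.coeff n))
    (fun n hn => Prod.ext (HahnSeries.coeff_eq_zero_of_lt_order (hn.trans_le (min_le_left _ _)))
      (HahnSeries.coeff_eq_zero_of_lt_order (hn.trans_le (min_le_right _ _))))
    (fun n => by
      ext
      · simpa [coneDifferential, add_comm] using congrArg Neg.neg (hf n)
      · simpa [coneDifferential, add_assoc] using hfg n)
  refine ⟨HahnSeries.ofSuppBddBelow (fun n => (w n).1) ⟨min f.order g.order, fun n hn => ?_⟩,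
    HahnSeries.ofSuppBddBelow (fun n => (w n).2) ⟨min f.order g.order, fun n hn => ?_⟩,
    fun n => ?_, fun n => ?_⟩
  · by_contra h
    exact hn (by simp [hw n (not_le.mp h)])
  · by_contra h
    exact hn (by simp [hw n (not_le.mp h)])
  · simpa [HahnSeries.ofSuppBddBelow, coneDifferential, add_comm] using congrArg Prod.fst (hDw n)
  · simpa [HahnSeries.ofSuppBddBelow, coneDifferential, add_assoc] using congrArg Prod.snd (hDw n)


/-- If `φ : (C, b, B) → (C', b', B')` is a quasi-isomorphism of mixed
complexes over a field `k` (it maps `ker b` into `ker b'`, `range b` into `range b'`, and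
the induced map on `b`-homology is bijective, stated elementwise), then the coefficientwise
map `φ((u)) : C((u)) → C'((u))` is a quasi-isomorphism for the total differentials
`D = b + uB` and `D' = b' + uB'` (again stated elementwise: the induced map
`ker D / range D → ker D' / range D'` is bijective). -/
theorem stmt_1 (k : Type*) [Field k]
    (C : Type*) [AddCommGroup C] [Module k C]
    (C' : Type*) [AddCommGroup C'] [Module k C']
    (b B : C →ₗ[k] C)
    (hbb : b ∘ₗ b = 0) (hBB : B ∘ₗ B = 0) (hbB : b ∘ₗ B + B ∘ₗ b = 0)
    (b' B' : C' →ₗ[k] C')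
    (hbb' : b' ∘ₗ b' = 0) (hBB' : B' ∘ₗ B' = 0) (hbB' : b' ∘ₗ B' + B' ∘ₗ b' = 0)
    (φ : C →ₗ[k] C') (hφb : φ ∘ₗ b = b' ∘ₗ φ) (hφB : φ ∘ₗ B = B' ∘ₗ φ)
    -- `φ` maps `ker b` into `ker b'` and `range b` into `range b'`:
    (hker : ∀ x : C, b x = 0 → b' (φ x) = 0)
    (hrange : ∀ x : C, φ (b x) ∈ LinearMap.range b')
    -- the induced map `ker b / range b → ker b' / range b'` is surjective:
    (hsurj : ∀ x' : C', b' x' = 0 → ∃ x : C, b x = 0 ∧ φ x - x' ∈ LinearMap.range b')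
    -- and injective:
    (hinj : ∀ x : C, b x = 0 → φ x ∈ LinearMap.range b' → x ∈ LinearMap.range b)
    -- the total differentials and the coefficientwise map `φ((u))`:
    (D : HahnSeries ℤ C →ₗ[k] HahnSeries ℤ C)
    (hD : ∀ (f : HahnSeries ℤ C) (n : ℤ),
      (D f).coeff n = b (f.coeff n) + B (f.coeff (n - 1)))
    (D' : HahnSeries ℤ C' →ₗ[k] HahnSeries ℤ C')
    (hD' : ∀ (f : HahnSeries ℤ C') (n : ℤ),
      (D' f).coeff n = b' (f.coeff n) + B' (f.coeff (n - 1)))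
    (Φ : HahnSeries ℤ C →ₗ[k] HahnSeries ℤ C')
    (hΦ : ∀ (f : HahnSeries ℤ C) (n : ℤ), (Φ f).coeff n = φ (f.coeff n)) :
    -- `φ((u))` maps `ker D` into `ker D'` and `range D` into `range D'`:
    (∀ f : HahnSeries ℤ C, D f = 0 → D' (Φ f) = 0) ∧
    (∀ f : HahnSeries ℤ C, Φ (D f) ∈ LinearMap.range D') ∧
    -- the induced map `ker D / range D → ker D' / range D'` is surjective:
    (∀ g : HahnSeries ℤ C', D' g = 0 →
      ∃ f : HahnSeries ℤ C, D f = 0 ∧ Φ f - g ∈ LinearMap.range D') ∧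
    -- and injective:
    (∀ f : HahnSeries ℤ C, D f = 0 → Φ f ∈ LinearMap.range D' →
      f ∈ LinearMap.range D) := by
  have hφb' : ∀ x, φ (b x) = b' (φ x) := LinearMap.congr_fun hφb
  have hφB' : ∀ x, φ (B x) = B' (φ x) := LinearMap.congr_fun hφB
  have hΦD : ∀ f, Φ (D f) = D' (Φ f) := fun f => by
    ext n
    simp only [hΦ, hD, hD', map_add, hφb', hφB']
  have hcone := exists_total_cone_eq b B b' B' φ (LinearMap.congr_fun hBB)
    (LinearMap.congr_fun hbB) (LinearMap.congr_fun hBB')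
    (LinearMap.congr_fun hbB') hφb' hφB' hsurj hinj
  refine ⟨fun f hf => by rw [← hΦD, hf, map_zero], fun f => ⟨Φ f, (hΦD f).symm⟩,
    fun g hg => ?_, fun f hf => ?_⟩
  · obtain ⟨x, y, hx, hy⟩ := hcone 0 g (by simp) (fun n => by simp [← hD', hg])
    refine ⟨x, ?_, -y, ?_⟩
    · ext n
      rw [hD]
      exact neg_eq_zero.mp (hx n)
    · ext n
      rw [map_neg, HahnSeries.coeff_neg, HahnSeries.coeff_sub, hD', hΦ, ← hy n]
      abel
  · rintro ⟨h, hh⟩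
    obtain ⟨x, y, hx, -⟩ := hcone f (-h) (fun n => by simp [← hD, hf]) (fun n => by
      rw [← hD', map_neg, hh, HahnSeries.coeff_neg, hΦ, add_neg_cancel])
    refine ⟨-x, ?_⟩
    ext n
    rw [map_neg, HahnSeries.coeff_neg, hD, hx]
end

section
/- Let k be a field of characteristic 0 and (C, b, B) a mixed complex over k. Let Γ and W be k-linear endomorphisms of C satisfying: (i) Γ ∘ B − B ∘ Γ = −(1/2)·B; (ii) (Γ ∘ b − b ∘ Γ) + (W ∘ B − B ∘ W) = (1/2)·b; (iii) W ∘ b = b ∘ W. Define the operator ∇ on C((u)) by (∇ f)_n = (n+1)·f_{n+1} + Γ(f_{n+1}) + W(f_{n+2}) (that is, ∇ = d/du + Γ/u + W/u²). Then ∇ is a u-connection on (C, b, B): ∇ ∘ D − D ∘ ∇ = (2u)^{-1} · D, where D = b + uB is the total differential on C((u)). (This is the algebraic identity underlying the paper's assertion that ∇_u^{DR} = d/du + Γ/u + W/u², with Γ acting as −p/2 on p-forms, is a u-connection on the twisted de Rham mixed complex (Ω•, −dW∧, d).) -/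
/-- Over a field `k` of characteristic `0`, let `(C, b, B)` be a mixed
complex and `Γ, W` `k`-linear endomorphisms of `C` with
(i) `Γ∘B − B∘Γ = −(1/2)·B`, (ii) `(Γ∘b − b∘Γ) + (W∘B − B∘W) = (1/2)·b`, (iii) `W∘b = b∘W`.
Then the operator `∇ = d/du + Γ/u + W/u²` on `C((u))`, given coefficientwise by
`(∇ f)ₙ = (n+1)·fₙ₊₁ + Γ fₙ₊₁ + W fₙ₊₂`, is a `u`-connection on `(C, b, B)`:
`∇ ∘ D − D ∘ ∇ = (2u)⁻¹ · D` where `D = b + uB` is the total differential. -/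
theorem stmt_4 (k : Type*) [Field k] [CharZero k]
    (C : Type*) [AddCommGroup C] [Module k C]
    (b B : C →ₗ[k] C)
    (hbb : b ∘ₗ b = 0) (hBB : B ∘ₗ B = 0) (hbB : b ∘ₗ B + B ∘ₗ b = 0)
    (Γ W : C →ₗ[k] C)
    (hΓB : Γ ∘ₗ B - B ∘ₗ Γ = -((2 : k)⁻¹ • B))
    (hΓb : (Γ ∘ₗ b - b ∘ₗ Γ) + (W ∘ₗ B - B ∘ₗ W) = (2 : k)⁻¹ • b)
    (hWb : W ∘ₗ b = b ∘ₗ W)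
    -- the total differential `D = b + uB`:
    (D : HahnSeries ℤ C →ₗ[k] HahnSeries ℤ C)
    (hD : ∀ (f : HahnSeries ℤ C) (n : ℤ),
      (D f).coeff n = b (f.coeff n) + B (f.coeff (n - 1)))
    -- the operator `∇ = d/du + Γ/u + W/u²`:
    (nabla : HahnSeries ℤ C → HahnSeries ℤ C)
    (hnabla : ∀ (f : HahnSeries ℤ C) (n : ℤ),
      (nabla f).coeff n =
        (n + 1) • f.coeff (n + 1) + Γ (f.coeff (n + 1)) + W (f.coeff (n + 2))) :
    -- `∇` is a `u`-connection: `∇ ∘ D − D ∘ ∇ = (2u)⁻¹ · D`, coefficientwise: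
    ∀ (f : HahnSeries ℤ C) (n : ℤ),
      (nabla (D f) - D (nabla f)).coeff n = (2 : k)⁻¹ • (D f).coeff (n + 1) := by
  intro f n
  have h₁ := LinearMap.congr_fun hΓB (f.coeff n)
  have h₂ := LinearMap.congr_fun hΓb (f.coeff (n + 1))
  have h₃ := LinearMap.congr_fun hWb (f.coeff (n + 2))
  simp only [LinearMap.sub_apply, LinearMap.add_apply, LinearMap.comp_apply,
    LinearMap.neg_apply, LinearMap.smul_apply] at h₁ h₂ h₃
  rw [HahnSeries.coeff_sub, hnabla, hD, hD, hD, hnabla, hnabla]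
  have e₁ : n + 1 - 1 = n := by ring
  have e₂ : n + 2 - 1 = n + 1 := by ring
  have e₃ : n - 1 + 1 = n := by ring
  have e₄ : n - 1 + 2 = n + 1 := by ring
  rw [e₁, e₂, e₃, e₄]
  simp only [map_add, map_zsmul, smul_add]
  have h_half : B (f.coeff n) = (2 : k)⁻¹ • B (f.coeff n) + (2 : k)⁻¹ • B (f.coeff n) := by
    rw [← add_smul, ← two_mul, mul_inv_cancel₀ two_ne_zero, one_smul]
  rw [h₃, ← h₂]
  rw [sub_eq_iff_eq_add] at h₁
  rw [h₁, add_smul n 1 (B (f.coeff n)), one_smul]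
  linear_combination (norm := module) h_half
end

section
/- Let k be a field and X a topological space in which every open subset is compact (a Noetherian topological space, e.g. the Zariski space of a scheme of finite type over a field). Let F be a sheaf of k-modules on X. Define the presheaf F((u)) by F((u))(U) := the k-module of formal Laurent series with coefficients in F(U) (functions ℤ → F(U) with support bounded below; in Lean, HahnSeries ℤ (F(U))), with restriction maps acting coefficientwise. Then F((u)) is a sheaf: for every open U ⊆ X, every open cover (U_i) of U and every family of sections s_i ∈ F((u))(U_i) such that s_i and s_j agree on U_i ∩ U_j for all i, j, there exists a unique s ∈ F((u))(U) whose restriction to each U_i equals s_i. -/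
open TopologicalSpace

/-- A cover of a compact open set by opens has a subcover indexed by some `Fin n`. -/
theorem TopologicalSpace.Opens.exists_fin_le_iSup_of_isCompact {X ι : Type*} [TopologicalSpace X]
    {U : Opens X} (hU : IsCompact (U : Set X)) (Us : ι → Opens X) (hcov : U ≤ iSup Us) :
    ∃ (n : ℕ) (e : Fin n → ι), U ≤ ⨆ a, Us (e a) := by
  obtain ⟨t, ht⟩ := hU.elim_finite_subcover (fun i => (Us i : Set X)) (fun i => (Us i).isOpen)
    (fun x hx => by simpa using hcov hx)
  refine ⟨t.card, fun a => t.equivFin.symm a, fun x hx => ?_⟩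
  obtain ⟨i, hi, hxi⟩ := Set.mem_iUnion₂.mp (ht hx)
  exact Opens.mem_iSup.mpr ⟨t.equivFin ⟨i, hi⟩, by simpa using hxi⟩

/-- A finite family of Laurent series has a common lower bound for its supports. -/
theorem HahnSeries.exists_forall_coeff_eq_zero_of_lt {α : Type*} [Finite α] {M : α → Type*}
    [∀ a, Zero (M a)] (s : ∀ a, HahnSeries ℤ (M a)) :
    ∃ N : ℤ, ∀ a, ∀ m < N, (s a).coeff m = 0 := by
  obtain ⟨N, hN⟩ := (Set.finite_range fun a => (s a).order).bddBelow
  exact ⟨N, fun a m hm => coeff_eq_zero_of_lt_order (hm.trans_le (hN ⟨a, rfl⟩))⟩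

/-- Let `k` be a field and `X` a topological space in which every open
subset is compact.  Let `F` be a sheaf of `k`-modules on `X` (given concretely by sections,
restriction maps and the sheaf axiom), and let `F((u))` be the presheaf of Laurent series
`U ↦ HahnSeries ℤ (F U)` with coefficientwise restriction maps `Res`.  Then `F((u))` is a
sheaf: for every open `U`, every open cover `(Uᵢ)` of `U` and every family of sections
`sᵢ ∈ F((u))(Uᵢ)` agreeing on the intersections `Uᵢ ⊓ Uⱼ`, there is a unique
`s ∈ F((u))(U)` restricting to `sᵢ` on each `Uᵢ`. -/
theorem stmt_5 (k : Type*) [Field k]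
    (X : Type*) [TopologicalSpace X]
    -- every open subset of `X` is compact:
    (hX : ∀ U : Set X, IsOpen U → IsCompact U)
    -- the sheaf `F` of `k`-modules:
    (F : Opens X → Type*) [∀ U, AddCommGroup (F U)] [∀ U, Module k (F U)]
    (res : ∀ {U V : Opens X}, V ≤ U → (F U →ₗ[k] F V))
    (res_id : ∀ (U : Opens X) (s : F U), res (le_refl U) s = s)
    (res_comp : ∀ {U V W : Opens X} (hVU : V ≤ U) (hWV : W ≤ V) (s : F U),
      res hWV (res hVU s) = res (hWV.trans hVU) s)
    -- the sheaf axiom for `F` (separation and gluing):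
    (F_sep : ∀ {ι : Type*} {U : Opens X} (Us : ι → Opens X) (hle : ∀ i, Us i ≤ U),
      U ≤ iSup Us → ∀ s t : F U, (∀ i, res (hle i) s = res (hle i) t) → s = t)
    (F_glue : ∀ {ι : Type*} {U : Opens X} (Us : ι → Opens X) (hle : ∀ i, Us i ≤ U),
      U ≤ iSup Us → ∀ s : ∀ i, F (Us i),
      (∀ i j, res (inf_le_left : Us i ⊓ Us j ≤ Us i) (s i) =
              res (inf_le_right : Us i ⊓ Us j ≤ Us j) (s j)) →
      ∃ t : F U, ∀ i, res (hle i) t = s i)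
    -- the coefficientwise restriction maps of the Laurent series presheaf `F((u))`:
    (Res : ∀ {U V : Opens X}, V ≤ U → (HahnSeries ℤ (F U) →ₗ[k] HahnSeries ℤ (F V)))
    (hRes : ∀ {U V : Opens X} (h : V ≤ U) (f : HahnSeries ℤ (F U)) (n : ℤ),
      (Res h f).coeff n = res h (f.coeff n)) :
    -- conclusion: `F((u))` is a sheaf:
    ∀ {ι : Type*} {U : Opens X} (Us : ι → Opens X) (hle : ∀ i, Us i ≤ U),
      U ≤ iSup Us → ∀ s : ∀ i, HahnSeries ℤ (F (Us i)),
      (∀ i j, Res (inf_le_left : Us i ⊓ Us j ≤ Us i) (s i) =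
              Res (inf_le_right : Us i ⊓ Us j ≤ Us j) (s j)) →
      ∃! t : HahnSeries ℤ (F U), ∀ i, Res (hle i) t = s i := by
  intro ι U Us hle hcov s hs
  obtain ⟨n, e, he⟩ := Opens.exists_fin_le_iSup_of_isCompact (hX U U.isOpen) Us hcov
  have hcoeff (i j : ι) (m : ℤ) : res (inf_le_left : Us i ⊓ Us j ≤ Us i) ((s i).coeff m) =
      res (inf_le_right : Us i ⊓ Us j ≤ Us j) ((s j).coeff m) := by
    rw [← hRes, ← hRes, hs]
  choose c hc using fun m : ℤ => F_glue (fun a : ULift (Fin n) => Us (e a.down))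
    (fun a => hle _) (he.trans_eq (iSup_ulift fun a => Us (e a.down)).symm)
    (fun a => (s (e a.down)).coeff m) (fun a b => hcoeff _ _ m)
  obtain ⟨N, hN⟩ := HahnSeries.exists_forall_coeff_eq_zero_of_lt fun a => s (e a)
  have hbdd : BddBelow (Function.support c) := by
    refine ⟨N, fun m hm => not_lt.mp fun hlt => hm ?_⟩
    refine F_sep (fun a : ULift (Fin n) => Us (e a.down)) (fun a => hle _)
      (he.trans_eq (iSup_ulift fun a => Us (e a.down)).symm) _ _ fun a => ?_
    rw [map_zero, hc m ⟨a.down⟩, hN a.down m hlt]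
  refine ⟨HahnSeries.ofSuppBddBelow c hbdd, fun i => ?_, fun t ht => ?_⟩
  · ext m
    rw [hRes]
    have hcov_i : Us i ≤ ⨆ a : ULift (Fin n), Us i ⊓ Us (e a.down) := by
      rw [← inf_iSup_eq]
      exact le_inf le_rfl ((hle i).trans (he.trans_eq (iSup_ulift fun a => Us (e a.down)).symm))
    refine F_sep (fun a : ULift (Fin n) => Us i ⊓ Us (e a.down)) (fun a => inf_le_left)
      hcov_i _ _ fun a => ?_
    rw [hcoeff, HahnSeries.coeff_ofSuppBddBelow, res_comp,
      ← res_comp (hle (e a.down)) inf_le_right, hc m ⟨a.down⟩]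
  · ext m
    refine F_sep (fun a : ULift (Fin n) => Us (e a.down)) (fun a => hle _)
      (he.trans_eq (iSup_ulift fun a => Us (e a.down)).symm) _ _ fun a => ?_
    rw [← hRes, ht, HahnSeries.coeff_ofSuppBddBelow, hc m ⟨a.down⟩]
end
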